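/- Let g be the pseudo-Riemannian metric on ℝ⁶ given by g = 2du₁⊗du₄ + 2du₂⊗du₅ + 2du₃⊗du₆ − 2u₁u₃u₅ du₁⊗du₁ − 2(u₁+u₃)u₅ du₃⊗du₃. Then g is a nilpotent Szabó metric: at every point of ℝ⁶ and for every tangent vector X ∈ ℝ⁶, the characteristic polynomial of the Szabó operator S(X) : Y ↦ (∇_X R)(Y,X)X equals λ⁶; in particular all eigenvalues of S(X) are zero. -/

import Mathlib

open scoped BigOperators

noncomputable section

variable {ι : Type} [Fintype ι] [DecidableEq ι]

/-- Partial derivative in the `i`-th coordinate direction. -/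
def pd (i : ι) (f : (ι → ℝ) → ℝ) : (ι → ℝ) → ℝ :=
  fun p => fderiv ℝ f p (Pi.single i 1)

/-- Curvature components `R^l_{ijk}` of the torsion-free connection with Christoffel
symbols `Γ k i j = Γᵏᵢⱼ`:
`Rˡᵢⱼₖ = ∂ᵢΓˡⱼₖ − ∂ⱼΓˡᵢₖ + Σₘ (Γˡᵢₘ Γᵐⱼₖ − Γˡⱼₘ Γᵐᵢₖ)`. -/
def curv (Γ : ι → ι → ι → (ι → ℝ) → ℝ) (l i j k : ι) : (ι → ℝ) → ℝ :=
  fun p => pd i (Γ l j k) p - pd j (Γ l i k) p +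
    ∑ m, (Γ l i m p * Γ m j k p - Γ l j m p * Γ m i k p)

/-- Components `(∇ₕR)ˡᵢⱼₖ` of the covariant derivative of the curvature. -/
def covR (Γ : ι → ι → ι → (ι → ℝ) → ℝ) (h l i j k : ι) : (ι → ℝ) → ℝ :=
  fun p => pd h (curv Γ l i j k) p +
    ∑ m, (Γ l h m p * curv Γ m i j k p - Γ m h i p * curv Γ l m j k p
      - Γ m h j p * curv Γ l i m k p - Γ m h k p * curv Γ l i j m p)

/-- The Szabó operator `S(X) : Y ↦ (∇_X R)(Y,X)X` at the point `p`, as a matrix: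
`(S(X)Y)ˡ = Σ_{h,i,j,k} Xʰ Yⁱ Xʲ Xᵏ (∇ₕR)ˡᵢⱼₖ`. -/
def szabo (Γ : ι → ι → ι → (ι → ℝ) → ℝ) (p X : ι → ℝ) : Matrix ι ι ℝ :=
  Matrix.of fun l i => ∑ h, ∑ j, ∑ k, X h * X j * X k * covR Γ h l i j k p

/-- Ricci tensor `Ricⱼₖ = Σᵢ Rⁱᵢⱼₖ`. -/
def ricci (Γ : ι → ι → ι → (ι → ℝ) → ℝ) (j k : ι) : (ι → ℝ) → ℝ :=
  fun p => ∑ i, curv Γ i i j k p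

/-- Covariant derivative of the Ricci tensor,
`(∇ᵢRic)ⱼₖ = ∂ᵢRicⱼₖ − Σₘ (Γᵐᵢⱼ Ricₘₖ + Γᵐᵢₖ Ricⱼₘ)`. -/
def covRic (Γ : ι → ι → ι → (ι → ℝ) → ℝ) (i j k : ι) : (ι → ℝ) → ℝ :=
  fun p => pd i (ricci Γ j k) p -
    ∑ m, (Γ m i j p * ricci Γ m k p + Γ m i k p * ricci Γ j m p)

/-- The Ricci tensor is cyclic parallel at `p`. -/
def CyclicParallelAt (Γ : ι → ι → ι → (ι → ℝ) → ℝ) (p : ι → ℝ) : Prop :=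
  ∀ i j k, covRic Γ i j k p + covRic Γ j k i p + covRic Γ k i j p = 0

/-- Christoffel symbols `Γ̃ᶜₐᵦ = ½ Σ_d g̃ᶜᵈ (∂ₐ g̃ᵦ_d + ∂ᵦ g̃ₐ_d − ∂_d g̃ₐᵦ)` of the
Levi-Civita connection of a pseudo-Riemannian metric `g`. -/
def christoffel (g : (ι → ℝ) → Matrix ι ι ℝ) (c a b : ι) : (ι → ℝ) → ℝ :=
  fun p => (1 / 2) * ∑ d, (g p)⁻¹ c d *
    (pd a (fun q => g q b d) p + pd b (fun q => g q a d) p - pd d (fun q => g q a b) p)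

end

/-- The pseudo-Riemannian metric on `ℝ⁶`:
`g = 2du₁⊗du₄ + 2du₂⊗du₅ + 2du₃⊗du₆ − 2u₁u₃u₅ du₁⊗du₁ − 2(u₁+u₃)u₅ du₃⊗du₃`. -/
def gSix : (Fin 6 → ℝ) → Matrix (Fin 6) (Fin 6) ℝ :=
  fun u =>
    !![-2 * u 0 * u 2 * u 4, 0, 0, 1, 0, 0;
       0, 0, 0, 0, 1, 0;
       0, 0, -2 * (u 0 + u 2) * u 4, 0, 0, 1;
       1, 0, 0, 0, 0, 0;
       0, 1, 0, 0, 0, 0;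
       0, 0, 1, 0, 0, 0]

/-- `f` is invariant under translations in the `i`-th coordinate direction. -/
def Inv6 (i : Fin 6) (f : (Fin 6 → ℝ) → ℝ) : Prop :=
  ∀ (t : ℝ) (p : Fin 6 → ℝ), f (p + t • Pi.single i 1) = f p

theorem Inv6.pd_eq_zero {i : Fin 6} {f : (Fin 6 → ℝ) → ℝ} (h : Inv6 i f)
    (p : Fin 6 → ℝ) : pd i f p = 0 := by
  unfold pd
  by_cases hd : DifferentiableAt ℝ f p
  · rw [← hd.lineDeriv_eq_fderiv]
    unfold lineDeriv
    simp only [h _ p]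
    simp
  · rw [fderiv_zero_of_not_differentiableAt hd]; rfl

theorem Inv6.pd {i : Fin 6} {f : (Fin 6 → ℝ) → ℝ} (h : Inv6 i f) (j : Fin 6) :
    Inv6 i (pd j f) := by
  intro t p
  unfold _root_.pd
  rw [← fderiv_comp_add_right (𝕜 := ℝ) (f := f) (t • Pi.single i 1)]
  have : (fun x => f (x + t • Pi.single i 1)) = f := funext (h t)
  rw [this]

theorem pd_const6 (j : Fin 6) (c : ℝ) (p : Fin 6 → ℝ) :
    pd j (fun _ : Fin 6 → ℝ => c) p = 0 := by
  simp [pd]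

/-- The explicit inverse of `gSix`. -/
def gSixInv : (Fin 6 → ℝ) → Matrix (Fin 6) (Fin 6) ℝ :=
  fun u =>
    !![0, 0, 0, 1, 0, 0;
       0, 0, 0, 0, 1, 0;
       0, 0, 0, 0, 0, 1;
       1, 0, 0, 2 * u 0 * u 2 * u 4, 0, 0;
       0, 1, 0, 0, 0, 0;
       0, 0, 1, 0, 0, 2 * (u 0 + u 2) * u 4]

theorem gSix_inv (u : Fin 6 → ℝ) : (gSix u)⁻¹ = gSixInv u := by
  apply Matrix.inv_eq_right_inv
  ext a b
  fin_cases a <;> fin_cases b <;>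
    simp [gSix, gSixInv, Matrix.mul_apply, Fin.sum_univ_six]

/-- Odd (zero-based) index. -/
def odd6 (i : Fin 6) : Prop := i = 1 ∨ i = 3 ∨ i = 5

theorem gSix_inv_zero (u : Fin 6 → ℝ) (c d : Fin 6) (hc : ¬ odd6 c) (hd : ¬ odd6 d) :
    (gSix u)⁻¹ c d = 0 := by
  rw [gSix_inv]
  fin_cases c <;> fin_cases d <;> simp [odd6] at hc hd <;> simp [gSixInv]

theorem gSix_trans {i : Fin 6} (hi : odd6 i) (t : ℝ) (p : Fin 6 → ℝ) :
    gSix (p + t • Pi.single i 1) = gSix p := by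
  rcases hi with rfl | rfl | rfl <;> simp [gSix, Pi.single_apply]

theorem gSix_const (a b : Fin 6) (h : odd6 a ∨ odd6 b) (p : Fin 6 → ℝ) :
    gSix p a b = gSix 0 a b := by
  rcases h with (rfl | rfl | rfl) | (rfl | rfl | rfl)
  · fin_cases b <;> simp [gSix]
  · fin_cases b <;> simp [gSix]
  · fin_cases b <;> simp [gSix]
  · fin_cases a <;> simp [gSix]
  · fin_cases a <;> simp [gSix]
  · fin_cases a <;> simp [gSix]

/-- All first derivatives of the metric with some odd index vanish. -/
theorem pd_gSix (j a b : Fin 6) (h : odd6 j ∨ odd6 a ∨ odd6 b) (p : Fin 6 → ℝ) :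
    pd j (fun q => gSix q a b) p = 0 := by
  rcases h with h | h
  · exact Inv6.pd_eq_zero (fun t p => by simp only [gSix_trans h]) p
  · simp only [gSix_const a b h]
    exact pd_const6 _ _ _

theorem chr_zero (c a b : Fin 6) (h : ¬ odd6 c ∨ odd6 a ∨ odd6 b) (p : Fin 6 → ℝ) :
    christoffel gSix c a b p = 0 := by
  unfold christoffel
  rw [Finset.sum_eq_zero, mul_zero]
  intro d _
  by_cases hab : odd6 a ∨ odd6 b ∨ odd6 d
  · rw [pd_gSix a b d (by tauto), pd_gSix b a d (by tauto), pd_gSix d a b (by tauto)]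
    ring
  · rw [gSix_inv_zero p c d (by tauto) (by tauto), zero_mul]

theorem chr_inv {i : Fin 6} (hi : odd6 i) (c a b : Fin 6) :
    Inv6 i (christoffel gSix c a b) := by
  have hg : ∀ a b, Inv6 i (fun q => gSix q a b) := fun a b t p => by
    simp only [gSix_trans hi]
  intro t p
  unfold christoffel
  simp only [gSix_trans hi, (hg _ _).pd _ t p]

theorem chr_mul (l a m b c : Fin 6) (p : Fin 6 → ℝ) :
    christoffel gSix l a m p * christoffel gSix m b c p = 0 := by
  by_cases hm : odd6 m
  · rw [chr_zero l a m (by tauto), zero_mul]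
  · rw [chr_zero m b c (by tauto), mul_zero]

theorem pd_chr (j c a b : Fin 6) (h : odd6 j ∨ ¬ odd6 c ∨ odd6 a ∨ odd6 b)
    (p : Fin 6 → ℝ) : pd j (christoffel gSix c a b) p = 0 := by
  rcases h with h | h
  · exact (chr_inv h c a b).pd_eq_zero p
  · have : christoffel gSix c a b = fun _ => 0 := funext (chr_zero c a b h)
    rw [this]
    exact pd_const6 _ _ _

theorem curv_zero (l i j k : Fin 6) (h : ¬ odd6 l ∨ odd6 i ∨ odd6 j ∨ odd6 k)
    (p : Fin 6 → ℝ) : curv (christoffel gSix) l i j k p = 0 := by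
  unfold curv
  simp only [chr_mul]
  rw [pd_chr i l j k (by tauto), pd_chr j l i k (by tauto)]
  simp

theorem covR_zero (h l i j k : Fin 6) (hh : ¬ odd6 l ∨ odd6 i) (p : Fin 6 → ℝ) :
    covR (christoffel gSix) h l i j k p = 0 := by
  unfold covR
  have h0 : curv (christoffel gSix) l i j k = fun _ => 0 :=
    funext (curv_zero l i j k (by tauto))
  rw [Finset.sum_eq_zero, h0, pd_const6, add_zero]
  intro m _
  by_cases hm : odd6 m
  · rw [chr_zero l h m (by tauto), curv_zero l m j k (by tauto),
      curv_zero l i m k (by tauto), curv_zero l i j m (by tauto)]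
    ring
  · rw [curv_zero m i j k (by tauto), chr_zero m h i (by tauto),
      chr_zero m h j (by tauto), chr_zero m h k (by tauto)]
    ring

theorem szabo_zero (u X : Fin 6 → ℝ) (l i : Fin 6) (hh : ¬ odd6 l ∨ odd6 i) :
    szabo (christoffel gSix) u X l i = 0 := by
  simp [szabo, covR_zero _ l i _ _ hh]

theorem szabo_sq (u X : Fin 6 → ℝ) : szabo (christoffel gSix) u X ^ 2 = 0 := by
  ext a b
  rw [sq, Matrix.mul_apply, Finset.sum_eq_zero]
  · rfl
  intro m _
  by_cases hm : odd6 m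
  · rw [szabo_zero u X a m (by tauto), zero_mul]
  · rw [szabo_zero u X m b (by tauto), mul_zero]

/-- `gSix` is a nilpotent Szabó metric: at every point of `ℝ⁶` and for every
tangent vector `X`, the characteristic polynomial of the Szabó operator
`S(X) : Y ↦ (∇_X R)(Y,X)X` of its Levi-Civita connection is `λ⁶`; in particular all
eigenvalues of `S(X)` are zero. -/
theorem stmt_11 :
    ∀ (u : Fin 6 → ℝ) (X : Fin 6 → ℝ),
      (szabo (christoffel gSix) u X).charpoly = Polynomial.X ^ 6 := by
  intro u X
  have h := Matrix.isNilpotent_charpoly_sub_pow_of_isNilpotent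
    (M := szabo (christoffel gSix) u X) ⟨2, szabo_sq u X⟩
  have h2 := sub_eq_zero.mp h.eq_zero
  simpa using h2
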